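/- Let A and B be groups with B nontrivial. For a ∈ A, let φ_a denote the automorphism of the free product A * B that restricts to conjugation x ↦ a x a⁻¹ on the factor A and to the identity on the factor B. Then φ_a is an inner automorphism of A * B if and only if a lies in the center of A. Consequently, the homomorphism A → Out(A * B), a ↦ [φ_a], has kernel equal to the center of A, and induces an injective homomorphism Inn(A) → Out(A * B). -/

import Mathlib

/-- The subgroup of inner automorphisms of `G`. -/
def Inn (G : Type*) [Group G] : Subgroup (MulAut G) := (MulAut.conj (G := G)).range

instance Inn.normal (G : Type*) [Group G] : (Inn G).Normal := by
  constructor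
  rintro f ⟨h, rfl⟩ g
  refine ⟨g h, ?_⟩
  ext x
  simp [MulAut.mul_apply, MulAut.conj_apply, map_mul, map_inv, MulAut.inv_def,
    MulEquiv.apply_symm_apply, mul_assoc]

/-- The outer automorphism group `Out(G) = Aut(G)/Inn(G)`. -/
abbrev Out (G : Type*) [Group G] : Type _ := MulAut G ⧸ Inn G

/-- `φ_a`: the endomorphism of the free product `A ∗ B` restricting to conjugation by `a`
on the factor `A` and to the identity on the factor `B` (it is an automorphism). -/
def phi (A B : Type*) [Group A] [Group B] (a : A) :
    Monoid.Coprod A B →* Monoid.Coprod A B :=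
  Monoid.Coprod.lift
    ((Monoid.Coprod.inl : A →* Monoid.Coprod A B).comp (MulAut.conj a).toMonoidHom)
    (Monoid.Coprod.inr : B →* Monoid.Coprod A B)

open Monoid in
/-- In a free product, an element commuting with a nontrivial element of a factor lies in
that factor. -/
theorem commute_of_mem_factor {ι : Type*} [DecidableEq ι] {G : ι → Type*} [∀ i, Group (G i)]
    [∀ i, DecidableEq (G i)]
    {i : ι} (b : G i) (hb : b ≠ 1) (h : CoprodI G)
    (hc : h * CoprodI.of b = CoprodI.of b * h) : ∃ k : G i, h = CoprodI.of k := by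
  obtain ⟨w, rfl⟩ := (CoprodI.Word.equiv (M := G)).symm.surjective h
  change w.prod * _ = _ * w.prod at hc
  change ∃ k : G i, w.prod = _
  obtain ⟨p, rfl⟩ := (CoprodI.Word.equivPair i).symm.surjective w
  rw [CoprodI.Word.equivPair_symm, CoprodI.Word.prod_rcons] at hc ⊢
  by_cases ht : p.tail = CoprodI.Word.empty
  · exact ⟨p.head, by simp [ht]⟩
  exfalso
  obtain ⟨j, l, t, htw⟩ := CoprodI.NeWord.of_word p.tail ht
  have hji : i ≠ j := by
    intro e
    apply p.fstIdx_ne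
    rw [← htw, CoprodI.Word.fstIdx]
    change (t.toList.head?.map Sigma.fst) = _
    rw [CoprodI.NeWord.toList_head?]
    simp [e]
  have hb1 : p.head⁻¹ * b * p.head ≠ 1 := by
    intro e
    apply hb
    have : b = p.head * (p.head⁻¹ * b * p.head) * p.head⁻¹ := by group
    rw [this, e]; simp
  let W := CoprodI.NeWord.append
    (CoprodI.NeWord.append t.inv hji.symm (CoprodI.NeWord.singleton _ hb1)) hji t
  have hW : W.prod = (CoprodI.NeWord.singleton b hb).prod := by
    simp only [W, CoprodI.NeWord.append_prod, CoprodI.NeWord.inv_prod,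
      CoprodI.NeWord.prod_singleton, map_mul, map_inv]
    have h2 : t.prod = p.tail.prod := by rw [← htw]; rfl
    rw [h2]
    have : CoprodI.of b * (CoprodI.of p.head * p.tail.prod)
      = CoprodI.of p.head * p.tail.prod * CoprodI.of b := hc.symm
    calc _ = (p.tail.prod)⁻¹ * (CoprodI.of p.head)⁻¹ *
          (CoprodI.of b * (CoprodI.of p.head * p.tail.prod)) := by group
      _ = _ := by rw [this]; group
  have hW2 : W.toWord = (CoprodI.NeWord.singleton b hb).toWord :=
    (CoprodI.Word.equiv (M := G)).symm.injective hW
  have hW3 : W.toList.length = 1 := by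
    have := congrArg (fun w => w.toList.length) hW2
    exact this
  have h1 : t.toList.length ≠ 0 := by
    intro e; exact t.toList_ne_nil (List.length_eq_zero_iff.mp e)
  simp [W, CoprodI.NeWord.toList] at hW3
  omega

open Monoid in
theorem coprod_fst_eq_one {A B : Type*} [Group A] [Group B] (b : B) (hb : b ≠ 1)
    (h : Coprod A B) (hc : h * Coprod.inr b = Coprod.inr b * h) : Coprod.fst h = 1 := by
  classical
  let f : Coprod A B →* CoprodI (fun _ : Bool => A × B) :=
    Coprod.lift ((CoprodI.of (M := fun _ : Bool => A × B) (i := true)).comp (MonoidHom.inl A B))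
      ((CoprodI.of (M := fun _ : Bool => A × B) (i := false)).comp (MonoidHom.inr A B))
  let g : CoprodI (fun _ : Bool => A × B) →* A :=
    CoprodI.lift (fun i => if i then MonoidHom.fst A B else 1)
  have hgf : g.comp f = Coprod.fst := by
    apply Coprod.hom_ext
    · ext x; simp [g, f]
    · ext x; simp [g, f]
  have hfb : f (Coprod.inr b) =
    CoprodI.of (M := fun _ : Bool => A × B) (i := false) (1, b) := by simp [f]
  obtain ⟨k, hk⟩ := commute_of_mem_factor (G := fun _ : Bool => A × B) (i := false) (1, b)
    (by simpa using hb) (f h) (by rw [← hfb, ← map_mul, hc, map_mul])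
  rw [← hgf, MonoidHom.comp_apply, hk]
  simp [g]

theorem phi_inner_iff (A B : Type*) [Group A] [Group B] [Nontrivial B] (a : A) :
    (∃ h : Monoid.Coprod A B, ∀ x, phi A B a x = h * x * h⁻¹) ↔ a ∈ Subgroup.center A := by
  constructor
  · rintro ⟨h, hh⟩
    obtain ⟨b, hb⟩ := exists_ne (1 : B)
    have h1 : Monoid.Coprod.fst h = 1 := by
      apply coprod_fst_eq_one b hb
      have := hh (Monoid.Coprod.inr b)
      simp only [phi, Monoid.Coprod.lift_apply_inr] at this
      rw [eq_mul_inv_iff_mul_eq] at this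
      exact this.symm
    rw [Subgroup.mem_center_iff]
    intro x
    have := congrArg Monoid.Coprod.fst (hh (Monoid.Coprod.inl x))
    simp [phi, h1] at this
    rw [mul_inv_eq_iff_eq_mul] at this
    exact this.symm
  · intro ha
    refine ⟨1, ?_⟩
    have : phi A B a = MonoidHom.id _ := by
      apply Monoid.Coprod.hom_ext
      · ext x
        have := Subgroup.mem_center_iff.mp ha x
        simp [phi, ← map_mul, ← map_inv, ← this]
      · ext x; simp [phi]
    intro x
    simp [this]

/-- **Statement 10.** Let `A`, `B` be groups with `B` nontrivial.  Then `φ_a` is an inner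
automorphism of `A ∗ B` iff `a` lies in the center of `A`.  Consequently, the homomorphism
`A → Out(A ∗ B)`, `a ↦ [φ_a]`, has kernel equal to the center of `A` and induces an
injective homomorphism `Inn(A) → Out(A ∗ B)`. -/
theorem stmt10 (A B : Type*) [Group A] [Group B] [Nontrivial B] :
    (∀ a : A,
      (∃ h : Monoid.Coprod A B, ∀ x, phi A B a x = h * x * h⁻¹) ↔ a ∈ Subgroup.center A) ∧
    (∀ Φ : A →* Out (Monoid.Coprod A B),
      (∀ a : A, ∃ f : MulAut (Monoid.Coprod A B),
        QuotientGroup.mk' (Inn (Monoid.Coprod A B)) f = Φ a ∧ ∀ x, f x = phi A B a x) →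
      Φ.ker = Subgroup.center A ∧
        ∀ Ψ : Inn A →* Out (Monoid.Coprod A B),
          (∀ a : A, Ψ ⟨MulAut.conj a, a, rfl⟩ = Φ a) → Function.Injective Ψ) := by
  refine ⟨phi_inner_iff A B, fun Φ hΦ => ?_⟩
  have hker : Φ.ker = Subgroup.center A := by
    ext a
    rw [← phi_inner_iff A B a, MonoidHom.mem_ker]
    obtain ⟨f, hf, hfx⟩ := hΦ a
    rw [← hf, QuotientGroup.mk'_apply, QuotientGroup.eq_one_iff]
    constructor
    · rintro ⟨h, rfl⟩
      exact ⟨h, fun x => by rw [← hfx, MulAut.conj_apply]⟩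
    · rintro ⟨h, hh⟩
      refine ⟨h, ?_⟩
      ext x
      rw [hfx, hh, MulAut.conj_apply]
  refine ⟨hker, fun Ψ hΨ => ?_⟩
  rw [injective_iff_map_eq_one]
  rintro ⟨_, a, rfl⟩ h
  rw [hΨ a, ← MonoidHom.mem_ker, hker, Subgroup.mem_center_iff] at h
  apply Subtype.ext
  ext x
  simp [MulAut.conj_apply, ← h x]
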